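/- arXiv:2505.15059 — 2 statements merged into one kernel-verified Lean document; each statement's English description precedes it below -/
import Mathlib

section
/- Spectral gap of the projected chain for Gaussian mixtures: Let M̂ be the projected chain on [L]×[n] associated with the approximate STMH chain M̃ (i.e., the projected chain of the decomposition theorem with p_{(i,j)} = p̃_{(i,j)} the density of N(μ_j, β_i⁻¹Σ), mixture weights w_{(i,j)} = w_j, level weights r_i, and X⁰ = {x : ‖x‖ ≤ R}). Let r = min_i r_i / max_i r_i, κ = γ_max/γ_min, D = max{ max_k ‖μ_k‖, √γ_min }. Fix constants c₁, c₂ > 0 and assume: (i) R ≥ √d·D and P̃_{(i,j)}(X⁰) ≥ 3/4 for all i ∈ [L], j ∈ [n]; (ii) c₁γ_min/D² < β₁ < c₂γ_min/D² and β₁ ≤ 1; (iii) β_{i+1}/β_i ≤ 1 + 1/√d for all i ∈ [L−1]. Then there is a constant c > 0 depending only on c₁ and c₂ such that SpecGap(M̂) ≥ 3 min{1−λ, λ} r² / (64 L² κ^{d/2} exp(c d)); equivalently Var_{P̂}(ĝ) ≤ (64 L² κ^{d/2} exp(cd)/(3 min{1−λ,λ} r²)) Ê(ĝ,ĝ) for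 all ĝ: [L]×[n] → ℝ. -/
open MeasureTheory Matrix Finset

noncomputable section

/-- Adjacency of temperature levels: `i' = i ± 1`. -/
def adjacent {L : ℕ} (i i' : Fin L) : Prop :=
  (i' : ℕ) = (i : ℕ) + 1 ∨ (i : ℕ) = (i' : ℕ) + 1

instance {L : ℕ} (i i' : Fin L) : Decidable (adjacent i i') := by
  unfold adjacent; infer_instance

/-- Euclidean norm of a vector in `ℝ^d`. -/
def euclNorm {d : ℕ} (v : Fin d → ℝ) : ℝ := Real.sqrt (∑ k, v k ^ 2)

/-- Quadratic form `v ↦ vᵀ Σ⁻¹ v`. -/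
def quadForm {d : ℕ} (Sig : Matrix (Fin d) (Fin d) ℝ) (v : Fin d → ℝ) : ℝ :=
  v ⬝ᵥ (Sig⁻¹ *ᵥ v)

/-- Density of the Gaussian distribution `N(μ, β⁻¹ Σ)` on `ℝ^d`. -/
def gaussDens {d : ℕ} (Sig : Matrix (Fin d) (Fin d) ℝ) (β : ℝ) (μ x : Fin d → ℝ) : ℝ :=
  (β / (2 * Real.pi)) ^ ((d : ℝ) / 2) / Real.sqrt Sig.det *
    Real.exp (-(β / 2) * quadForm Sig (x - μ))


lemma tele_aux (N : ℕ) (f : ℕ → ℝ) (i : ℕ) (hi : i ≤ N) :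
    (f i - f 0) ^ 2 ≤ N * ∑ l ∈ Finset.range N, (f (l + 1) - f l) ^ 2 := by
  rw [← Finset.sum_range_sub f i]
  have h1 := sq_sum_le_card_mul_sum_sq (s := Finset.range i) (f := fun l => f (l + 1) - f l)
  rw [Finset.card_range] at h1
  refine h1.trans ?_
  have h2 : ∑ l ∈ Finset.range i, (f (l + 1) - f l) ^ 2
      ≤ ∑ l ∈ Finset.range N, (f (l + 1) - f l) ^ 2 :=
    Finset.sum_le_sum_of_subset_of_nonneg (Finset.range_mono hi) (fun _ _ _ => sq_nonneg _)
  have h3 : (i : ℝ) ≤ N := by exact_mod_cast hi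
  have h4 : 0 ≤ ∑ l ∈ Finset.range i, (f (l + 1) - f l) ^ 2 :=
    Finset.sum_nonneg (fun _ _ => sq_nonneg _)
  exact mul_le_mul h3 h2 h4 (by positivity)

lemma tele_fin (L : ℕ) (hL : 0 < L) (f : Fin L → ℝ) (i : Fin L) :
    (f i - f ⟨0, hL⟩) ^ 2 ≤ L * ∑ l : Fin L, ∑ l' : Fin L,
      if (l' : ℕ) = l + 1 then (f l' - f l) ^ 2 else 0 := by
  have h := tele_aux L (fun k => f ⟨min k (L - 1), by omega⟩) i i.2.le
  have e1 : (⟨min (i : ℕ) (L - 1), by omega⟩ : Fin L) = i := by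
    apply Fin.ext; simp; omega
  have e2 : (⟨min 0 (L - 1), by omega⟩ : Fin L) = ⟨0, hL⟩ := by
    apply Fin.ext; simp
  simp only [e1, e2] at h
  refine h.trans ?_
  rw [Finset.sum_range]
  refine mul_le_mul_of_nonneg_left (Finset.sum_le_sum fun l _ => ?_) (by positivity)
  have e3 : (⟨min (l : ℕ) (L - 1), by omega⟩ : Fin L) = l := by
    apply Fin.ext; simp; omega
  simp only [e3]
  by_cases hl : (l : ℕ) + 1 < L
  · have e4 : (⟨min ((l : ℕ) + 1) (L - 1), by omega⟩ : Fin L) = ⟨l + 1, hl⟩ := by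
      apply Fin.ext; simp; omega
    rw [e4]
    have := Finset.single_le_sum (s := Finset.univ)
      (f := fun l' : Fin L => if (l' : ℕ) = l + 1 then (f l' - f l) ^ 2 else 0)
      (fun x _ => by split_ifs <;> positivity) (Finset.mem_univ ⟨(l : ℕ) + 1, hl⟩)
    simpa using this
  · have e4 : (⟨min ((l : ℕ) + 1) (L - 1), by omega⟩ : Fin L) = l := by
      apply Fin.ext; simp; omega
    rw [e4]
    simp only [sub_self, ne_eq, OfNat.ofNat_ne_zero, not_false_eq_true, zero_pow]
    exact Finset.sum_nonneg fun x _ => by split_ifs <;> positivity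

lemma chain_bound (L n : ℕ) (hL : 2 ≤ L) (r : Fin L → ℝ) (w : Fin n → ℝ)
    (P : Fin L → Fin n → ℝ) (hr : ∀ i, 0 < r i) (hr1 : ∑ i, r i = 1)
    (hw : ∀ j, 0 < w j) (hw1 : ∑ j, w j = 1)
    (hP : ∀ i j, 3 / 4 ≤ P i j) (hP1 : ∀ i j, P i j ≤ 1)
    (Z : ℝ) (hZ : Z = ∑ b : Fin L × Fin n, r b.1 * w b.2 * P b.1 b.2)
    (p : Fin L × Fin n → ℝ) (hp : ∀ a, p a = r a.1 * w a.2 * P a.1 a.2 / Z)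
    (M : Fin L × Fin n → Fin L × Fin n → ℝ) (al : ℝ) (hal : 0 < al)
    (hM0 : ∀ a b, a ≠ b → 0 ≤ M a b)
    (hMv : ∀ a b, (b.1 : ℕ) = a.1 + 1 → a.2 = b.2 → w a.2 * al / Z ≤ p a * M a b)
    (hMh : ∀ a b, (a.1 : ℕ) = 0 → (b.1 : ℕ) = 0 → a.2 ≠ b.2 →
      w a.2 * w b.2 * al / Z ≤ p a * M a b)
    (g : Fin L × Fin n → ℝ) :
    (1 / 2) * ∑ a, ∑ b, (g b - g a) ^ 2 * p a * p b ≤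
      6 * L / al * ((1 / 2) * ∑ a, ∑ b, (g b - g a) ^ 2 * p a * M a b) := by
  have hsum1 : ∑ b : Fin L × Fin n, r b.1 * w b.2 = 1 := by
    rw [Fintype.sum_prod_type]
    simp only [← Finset.mul_sum, hw1, hr1, mul_one]
  have hZ34 : 3 / 4 ≤ Z := by
    rw [hZ]
    calc (3 / 4 : ℝ) = ∑ b : Fin L × Fin n, r b.1 * w b.2 * (3 / 4) := by
          rw [← Finset.sum_mul, hsum1, one_mul]
      _ ≤ _ := Finset.sum_le_sum fun b _ =>
          mul_le_mul_of_nonneg_left (hP _ _) (mul_pos (hr _) (hw _)).le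
  have hZpos : 0 < Z := by linarith
  have hp0 : ∀ a, 0 ≤ p a := fun a => by
    rw [hp]
    have := hP a.1 a.2
    have h1 := hr a.1
    have h2 := hw a.2
    have h3 : 0 < P a.1 a.2 := by linarith
    positivity
  have hpsum : ∑ a, p a = 1 := by
    simp only [hp, ← Finset.sum_div, ← hZ]
    exact div_self hZpos.ne'
  have hple : ∀ a, p a ≤ r a.1 * w a.2 / Z := fun a => by
    rw [hp]
    apply div_le_div_of_nonneg_right _ hZpos.le
    exact mul_le_of_le_one_right (mul_pos (hr _) (hw _)).le (hP1 _ _)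
  set z : Fin L := ⟨0, by omega⟩ with hz
  set S : Fin n → ℝ := fun j => ∑ l : Fin L, ∑ l' : Fin L,
      if (l' : ℕ) = l + 1 then (g (l', j) - g (l, j)) ^ 2 else 0 with hS
  have hS0 : ∀ j, 0 ≤ S j := fun j =>
    Finset.sum_nonneg fun _ _ => Finset.sum_nonneg fun _ _ => by split_ifs <;> positivity
  set H : Fin n → Fin n → ℝ := fun j j' => (g (z, j') - g (z, j)) ^ 2 with hH
  have hH0 : ∀ j j', 0 ≤ H j j' := fun j j' => sq_nonneg _
  set A := ∑ j, w j * S j with hA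
  set B := ∑ j, ∑ j', w j * w j' * H j j' with hB
  have hA0 : 0 ≤ A := Finset.sum_nonneg fun j _ => mul_nonneg (hw j).le (hS0 j)
  have hB0 : 0 ≤ B := Finset.sum_nonneg fun j _ => Finset.sum_nonneg fun j' _ =>
    mul_nonneg (mul_pos (hw j) (hw j')).le (hH0 j j')
  have hL2 : (2 : ℝ) ≤ L := by exact_mod_cast hL
  -- upper bound
  have hpt : ∀ a b, (g b - g a) ^ 2 ≤ 3 * (L * S a.2 + H a.2 b.2 + L * S b.2) := by
    intro a b
    have h1 := tele_fin L (by omega) (fun i => g (i, a.2)) a.1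
    have h2 := tele_fin L (by omega) (fun i => g (i, b.2)) b.1
    have h1' : (g a - g (z, a.2)) ^ 2 ≤ L * S a.2 := h1
    have h2' : (g b - g (z, b.2)) ^ 2 ≤ L * S b.2 := h2
    have h3 : H a.2 b.2 = (g (z, b.2) - g (z, a.2)) ^ 2 := rfl
    rw [h3]
    nlinarith [sq_nonneg ((g a - g (z, a.2)) + (g (z, b.2) - g (z, a.2))),
      sq_nonneg ((g b - g (z, b.2)) - (g (z, b.2) - g (z, a.2))),
      sq_nonneg ((g a - g (z, a.2)) + (g b - g (z, b.2)))]
  have hpS : ∑ a, p a * S a.2 ≤ A / Z := by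
    calc ∑ a, p a * S a.2 ≤ ∑ a : Fin L × Fin n, (r a.1 * w a.2 / Z) * S a.2 :=
          Finset.sum_le_sum fun a _ => mul_le_mul_of_nonneg_right (hple a) (hS0 _)
      _ = ∑ i, r i * (A / Z) := by
          rw [Fintype.sum_prod_type]
          refine Finset.sum_congr rfl fun i _ => ?_
          rw [hA, Finset.sum_div, Finset.mul_sum]
          refine Finset.sum_congr rfl fun j _ => ?_
          ring
      _ = A / Z := by rw [← Finset.sum_mul, hr1, one_mul]
  have hpH : ∑ a, ∑ b, p a * p b * H a.2 b.2 ≤ B / Z / Z := by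
    calc ∑ a, ∑ b, p a * p b * H a.2 b.2
        ≤ ∑ a : Fin L × Fin n, ∑ b : Fin L × Fin n,
          (r a.1 * w a.2 / Z) * (r b.1 * w b.2 / Z) * H a.2 b.2 :=
          Finset.sum_le_sum fun a _ => Finset.sum_le_sum fun b _ =>
            mul_le_mul_of_nonneg_right
              (mul_le_mul (hple a) (hple b) (hp0 b) ((hp0 a).trans (hple a))) (hH0 _ _)
      _ = ∑ i, ∑ i', r i * r i' * (B / Z / Z) := by
          rw [Fintype.sum_prod_type]
          refine Finset.sum_congr rfl fun i _ => ?_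
          simp only [Fintype.sum_prod_type]
          rw [Finset.sum_comm]
          refine Finset.sum_congr rfl fun i' _ => ?_
          rw [hB, Finset.sum_div, Finset.sum_div, Finset.mul_sum]
          refine Finset.sum_congr rfl fun j _ => ?_
          rw [Finset.sum_div, Finset.sum_div, Finset.mul_sum]
          refine Finset.sum_congr rfl fun j' _ => ?_
          ring
      _ = B / Z / Z := by
          simp only [← Finset.sum_mul, ← Finset.mul_sum, hr1, one_mul, mul_one]
  have hV : ∑ a, ∑ b, (g b - g a) ^ 2 * p a * p b ≤ 6 * L / Z * (A + B) := by
    calc ∑ a, ∑ b, (g b - g a) ^ 2 * p a * p b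
        ≤ ∑ a, ∑ b, (3 * L * (p a * S a.2) * p b + 3 * (p a * p b * H a.2 b.2)
            + 3 * L * p a * (p b * S b.2)) :=
          Finset.sum_le_sum fun a _ => Finset.sum_le_sum fun b _ => by
            have := mul_le_mul_of_nonneg_right (hpt a b) (mul_nonneg (hp0 a) (hp0 b))
            linarith
      _ = 6 * L * (∑ a, p a * S a.2) + 3 * ∑ a, ∑ b, p a * p b * H a.2 b.2 := by
          simp only [Finset.sum_add_distrib, ← Finset.mul_sum, ← Finset.sum_mul, hpsum]
          ring
      _ ≤ 6 * L * (A / Z) + 3 * (B / Z / Z) := by gcongr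
      _ ≤ 6 * L / Z * (A + B) := by
          have hBZ : 0 ≤ B / Z := by positivity
          have : B / Z / Z ≤ 2 * L * (B / Z) := by
            rw [div_le_iff₀ hZpos]
            have : 1 ≤ 2 * L * Z := by nlinarith
            nlinarith
          have e : 6 * L / Z * (A + B) = 6 * L * (A / Z) + 6 * L * (B / Z) := by ring
          rw [e]; linarith
  -- lower bound
  have hE : al / Z * (A + B) ≤ ∑ a, ∑ b, (g b - g a) ^ 2 * p a * M a b := by
    have key : ∀ a b : Fin L × Fin n,
        al / Z * ((if a.2 = b.2 then (if (b.1 : ℕ) = a.1 + 1 then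
            w a.2 * (g (b.1, a.2) - g (a.1, a.2)) ^ 2 else 0) else 0)
          + (if a.1 = z then (if b.1 = z then w a.2 * w b.2 * H a.2 b.2 else 0) else 0))
        ≤ (g b - g a) ^ 2 * p a * M a b := by
      rintro ⟨i, j⟩ ⟨i', j'⟩
      by_cases hab : (i, j) = (i', j')
      · rw [hab]
        have : ¬ ((i' : ℕ) = i' + 1) := by omega
        simp [hH]
      have hnn : 0 ≤ (g (i', j') - g (i, j)) ^ 2 * p (i, j) * M (i, j) (i', j') :=
        mul_nonneg (mul_nonneg (sq_nonneg _) (hp0 _)) (hM0 _ _ hab)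
      dsimp only
      by_cases h1 : j = j' ∧ (i' : ℕ) = i + 1
      · obtain ⟨rfl, h2⟩ := h1
        have h3 : ¬ (i' = z) := by
          intro h; rw [h, hz] at h2; simp at h2
        rw [if_pos rfl, if_pos h2, if_neg h3]
        have := mul_le_mul_of_nonneg_left (hMv (i, j) (i', j) h2 rfl)
          (sq_nonneg (g (i', j) - g (i, j)))
        dsimp only at this
        calc _ = (g (i', j) - g (i, j)) ^ 2 * (w j * al / Z) := by
              split_ifs <;> ring
          _ ≤ _ := this
          _ = _ := by ring
      · have e0 : (if j = j' then (if (i' : ℕ) = i + 1 then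
            w j * (g (i', j) - g (i, j)) ^ 2 else 0) else 0) = 0 := by
          split_ifs <;> first | rfl | (exfalso; tauto)
        rw [e0, zero_add]
        by_cases h2 : i = z ∧ i' = z
        · obtain ⟨rfl, rfl⟩ := h2
          have hj : j ≠ j' := fun h => hab (by rw [h])
          rw [if_pos rfl, if_pos rfl]
          have := mul_le_mul_of_nonneg_left (hMh (z, j) (z, j') rfl rfl hj)
            (sq_nonneg (g (z, j') - g (z, j)))
          dsimp only at this
          calc _ = (g (z, j') - g (z, j)) ^ 2 * (w j * w j' * al / Z) := by
                simp only [hH]; ring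
            _ ≤ _ := this
            _ = _ := by ring
        · have e1 : (if i = z then (if i' = z then w j * w j' * H j j' else 0) else 0) = 0 := by
            split_ifs <;> first | rfl | (exfalso; tauto)
          rw [e1, mul_zero]
          exact hnn
    refine le_trans (le_of_eq ?_) (Finset.sum_le_sum fun a _ => Finset.sum_le_sum fun b _ => key a b)
    simp only [← Finset.mul_sum, Finset.sum_add_distrib]
    congr 2
    · rw [Fintype.sum_prod_type, Finset.sum_comm]
      rw [hA]
      refine Finset.sum_congr rfl fun j _ => ?_
      rw [hS, Finset.mul_sum]
      refine Finset.sum_congr rfl fun l _ => ?_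
      rw [Finset.mul_sum, Fintype.sum_prod_type]
      refine Finset.sum_congr rfl fun l' _ => ?_
      simp
    · rw [Fintype.sum_prod_type]
      simp only [Fintype.sum_prod_type]
      rw [Finset.sum_eq_single z (fun i _ hi => by simp [hi]) (by simp)]
      rw [hB]
      refine Finset.sum_congr rfl fun j _ => ?_
      rw [Finset.sum_eq_single z (fun i _ hi => by simp [hi]) (by simp)]
      simp
  have hfin : 6 * L / Z * (A + B) ≤ 6 * L / al * ∑ a, ∑ b, (g b - g a) ^ 2 * p a * M a b := by
    calc 6 * L / Z * (A + B) = 6 * L / al * (al / Z * (A + B)) := by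
          field_simp
      _ ≤ _ := mul_le_mul_of_nonneg_left hE (by positivity)
  linarith

lemma rayleigh_lower {d : ℕ} (Sig : Matrix (Fin d) (Fin d) ℝ) (hSig : Sig.PosDef) (γ : ℝ)
    (hγ : γ ∈ lowerBounds (Set.range hSig.isHermitian.eigenvalues)) (u : Fin d → ℝ) :
    γ * (u ⬝ᵥ u) ≤ u ⬝ᵥ (Sig *ᵥ u) := by
  have hH : (Sig - algebraMap ℝ _ γ).IsHermitian := by
    apply hSig.isHermitian.sub
    rw [Matrix.algebraMap_eq_diagonal]
    exact Matrix.isHermitian_diagonal _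
  have hps : (Sig - algebraMap ℝ _ γ).PosSemidef := by
    rw [hH.posSemidef_iff_eigenvalues_nonneg]
    intro i
    have h := hH.eigenvalues_mem_spectrum_real i
    rw [← spectrum.sub_singleton_eq, hSig.isHermitian.spectrum_real_eq_range_eigenvalues] at h
    obtain ⟨x, hx, y, hy, hxy⟩ := Set.mem_sub.1 h
    have := hγ hx
    rw [Set.mem_singleton_iff] at hy
    show (0 : ℝ) ≤ _
    linarith
  have h := hps.dotProduct_mulVec_nonneg u
  rw [Matrix.sub_mulVec, dotProduct_sub, Algebra.algebraMap_eq_smul_one, Matrix.smul_mulVec,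
    Matrix.one_mulVec, dotProduct_smul, star_trivial, smul_eq_mul] at h
  linarith

lemma quadForm_nonneg {d : ℕ} (Sig : Matrix (Fin d) (Fin d) ℝ) (hSig : Sig.PosDef)
    (v : Fin d → ℝ) : 0 ≤ quadForm Sig v := by
  have h := hSig.inv.posSemidef.dotProduct_mulVec_nonneg v
  rwa [star_trivial] at h

lemma quadForm_le {d : ℕ} (Sig : Matrix (Fin d) (Fin d) ℝ) (hSig : Sig.PosDef) (γ : ℝ)
    (hγ0 : 0 < γ)
    (hγ : γ ∈ lowerBounds (Set.range hSig.isHermitian.eigenvalues)) (v : Fin d → ℝ) :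
    quadForm Sig v ≤ (∑ k, v k ^ 2) / γ := by
  set u := Sig⁻¹ *ᵥ v with hu
  have hv : Sig *ᵥ u = v := by
    rw [hu, Matrix.mulVec_mulVec, Matrix.mul_nonsing_inv _ hSig.det_pos.ne'.isUnit,
      Matrix.one_mulVec]
  have h1 := rayleigh_lower Sig hSig γ hγ u
  rw [hv] at h1
  have hq : quadForm Sig v = ∑ k, u k * v k := by
    show v ⬝ᵥ u = _
    rw [dotProduct_comm]; rfl
  have h2 : γ * ∑ k, u k ^ 2 ≤ ∑ k, u k * v k := by
    simpa [dotProduct, pow_two] using h1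
  have h3 : (∑ k, u k * v k) ^ 2 ≤ (∑ k, u k ^ 2) * ∑ k, v k ^ 2 :=
    Finset.sum_mul_sq_le_sq_mul_sq _ _ _
  have hn := quadForm_nonneg Sig hSig v
  rw [hq] at hn ⊢
  have hV : 0 ≤ ∑ k, v k ^ 2 := Finset.sum_nonneg fun _ _ => sq_nonneg _
  rw [le_div_iff₀ hγ0]
  rcases hn.eq_or_lt with h | h
  · rw [← h]; simpa using hV
  · by_contra hc
    push Not at hc
    nlinarith [mul_le_mul_of_nonneg_right h2 hV]

lemma det_le_pow {d : ℕ} (Sig : Matrix (Fin d) (Fin d) ℝ) (hSig : Sig.PosDef) (γ : ℝ)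
    (hγ : γ ∈ upperBounds (Set.range hSig.isHermitian.eigenvalues)) : Sig.det ≤ γ ^ d := by
  rw [hSig.isHermitian.det_eq_prod_eigenvalues]
  calc _ ≤ ∏ _i : Fin d, γ := Finset.prod_le_prod
        (fun i _ => (hSig.eigenvalues_pos i).le) (fun i _ => hγ ⟨i, rfl⟩)
    _ = γ ^ d := by simp

lemma quadForm_continuous {d : ℕ} (Sig : Matrix (Fin d) (Fin d) ℝ) :
    Continuous (quadForm Sig) := by
  unfold quadForm
  fun_prop

lemma gaussDens_continuous {d : ℕ} (Sig : Matrix (Fin d) (Fin d) ℝ) (β : ℝ) (μ : Fin d → ℝ) :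
    Continuous (gaussDens Sig β μ) := by
  have := quadForm_continuous Sig
  unfold gaussDens
  fun_prop

lemma gaussDens_pos {d : ℕ} (Sig : Matrix (Fin d) (Fin d) ℝ) (hSig : Sig.PosDef) (β : ℝ)
    (hβ : 0 < β) (μ x : Fin d → ℝ) : 0 < gaussDens Sig β μ x := by
  have := Real.sqrt_pos.2 hSig.det_pos
  unfold gaussDens
  positivity

open scoped MatrixOrder in
lemma gaussDens_integral {d : ℕ} (Sig : Matrix (Fin d) (Fin d) ℝ) (hSig : Sig.PosDef) (β : ℝ)
    (hβ : 0 < β) (μ : Fin d → ℝ) :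
    Integrable (gaussDens Sig β μ) ∧ ∫ x, gaussDens Sig β μ x = 1 := by
  obtain ⟨B, hB⟩ : ∃ B : Matrix (Fin d) (Fin d) ℝ, Sig⁻¹ = Bᴴ * B :=
    CStarAlgebra.nonneg_iff_eq_star_mul_self.mp hSig.inv.posSemidef.nonneg
  have hq : ∀ v, quadForm Sig v = ∑ k, (toLin' B v) k ^ 2 := by
    intro v
    unfold quadForm
    rw [hB, ← Matrix.mulVec_mulVec, Matrix.dotProduct_mulVec, Matrix.vecMul_conjTranspose]
    simp [dotProduct, pow_two, Matrix.toLin'_apply]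
  have hdet : B.det ^ 2 = Sig.det⁻¹ := by
    have := congrArg Matrix.det hB
    rw [Matrix.det_mul, Matrix.det_conjTranspose, star_trivial, Matrix.det_nonsing_inv,
      Ring.inverse_eq_inv'] at this
    rw [pow_two, this]
  have hdS := hSig.det_pos
  have hB0 : B.det ≠ 0 := by
    intro h
    rw [h] at hdet
    have := inv_pos.2 hdS
    simp at hdet
    linarith
  set F : (Fin d → ℝ) → ℝ := fun y => ∏ k, Real.exp (-(β / 2) * y k ^ 2) with hF
  have hFi : Integrable F := by
    refine Integrable.fintype_prod (f := fun _ y => Real.exp (-(β / 2) * y ^ 2)) fun i => ?_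
    exact integrable_exp_neg_mul_sq (by positivity)
  have hFint : ∫ y, F y = (Real.sqrt (Real.pi / (β / 2))) ^ d := by
    rw [hF, integral_fintype_prod_volume_eq_pow (fun y => Real.exp (-(β / 2) * y ^ 2)),
      integral_gaussian, Fintype.card_fin]
  have hmap := Real.map_matrix_volume_pi_eq_smul_volume_pi hB0
  have hmeas : Measurable (toLin' B) := (LinearMap.continuous_on_pi _).measurable
  have hFm : Continuous F := by rw [hF]; fun_prop
  have hFBi : Integrable (fun v => F (toLin' B v)) := by
    have : Integrable F (Measure.map (toLin' B) volume) := by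
      rw [hmap]
      exact hFi.smul_measure ENNReal.ofReal_ne_top
    exact this.comp_measurable hmeas
  have hFBint : ∫ v, F (toLin' B v) = |B.det⁻¹| * (Real.sqrt (Real.pi / (β / 2))) ^ d := by
    rw [← integral_map hmeas.aemeasurable hFm.aestronglyMeasurable, hmap, integral_smul_measure,
      hFint, ENNReal.toReal_ofReal (abs_nonneg _), smul_eq_mul]
  have hG : ∀ x, gaussDens Sig β μ x =
      (β / (2 * Real.pi)) ^ ((d : ℝ) / 2) / Real.sqrt Sig.det * F (toLin' B (x - μ)) := by
    intro x
    unfold gaussDens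
    rw [hq, Finset.mul_sum, Real.exp_sum]
  have hfun : gaussDens Sig β μ = fun x =>
      (β / (2 * Real.pi)) ^ ((d : ℝ) / 2) / Real.sqrt Sig.det * F (toLin' B (x - μ)) := funext hG
  rw [hfun]
  refine ⟨(hFBi.comp_sub_right μ).const_mul _, ?_⟩
  rw [integral_const_mul, integral_sub_right_eq_self (fun v => F (toLin' B v)) μ, hFBint]
  have e1 : |B.det⁻¹| = Real.sqrt Sig.det := by
    rw [← Real.sqrt_sq_eq_abs, inv_pow, hdet, inv_inv]
  have e2 : (Real.sqrt (Real.pi / (β / 2))) ^ d = ((β / (2 * Real.pi)) ^ ((d : ℝ) / 2))⁻¹ := by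
    rw [← Real.rpow_natCast, Real.sqrt_eq_rpow, ← Real.rpow_mul (by positivity),
      ← Real.inv_rpow (by positivity)]
    congr 1
    · field_simp
    · ring
  rw [e1, e2]
  have h1 : Real.sqrt Sig.det ≠ 0 := (Real.sqrt_pos.2 hdS).ne'
  have h2 : (β / (2 * Real.pi)) ^ ((d : ℝ) / 2) ≠ 0 := (Real.rpow_pos_of_pos (by positivity) _).ne'
  field_simp

lemma gaussDens_ratio {d : ℕ} (Sig : Matrix (Fin d) (Fin d) ℝ) (hSig : Sig.PosDef) (β β' : ℝ)
    (hβ : 0 < β) (h1 : β ≤ β') (h2 : β' ≤ 2 * β) (μ x : Fin d → ℝ) :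
    Real.exp (-(d : ℝ)) * gaussDens Sig β' μ x ≤ gaussDens Sig β μ x := by
  have hs := Real.sqrt_pos.2 hSig.det_pos
  have hq := quadForm_nonneg Sig hSig (x - μ)
  unfold gaussDens
  have e1 : Real.exp (-(β' / 2) * quadForm Sig (x - μ)) ≤
      Real.exp (-(β / 2) * quadForm Sig (x - μ)) := by
    apply Real.exp_le_exp.2
    nlinarith
  have e2 : Real.exp (-(d : ℝ)) * (β' / (2 * Real.pi)) ^ ((d : ℝ) / 2) ≤
      (β / (2 * Real.pi)) ^ ((d : ℝ) / 2) := by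
    have a1 : (β' / (2 * Real.pi)) ^ ((d : ℝ) / 2) ≤
        (2 * (β / (2 * Real.pi))) ^ ((d : ℝ) / 2) := by
      apply Real.rpow_le_rpow
      · have : 0 < β' := by linarith
        positivity
      · rw [mul_div_assoc']
        gcongr
      · positivity
    rw [Real.mul_rpow (by norm_num) (by positivity)] at a1
    have a2 : (2 : ℝ) ^ ((d : ℝ) / 2) ≤ Real.exp d := by
      rw [Real.rpow_def_of_pos (by norm_num)]
      apply Real.exp_le_exp.2
      have : Real.log 2 ≤ 1 := by
        have := Real.log_two_lt_d9; linarith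
      have hd : (0 : ℝ) ≤ d := by positivity
      nlinarith
    have hN : 0 ≤ (β / (2 * Real.pi)) ^ ((d : ℝ) / 2) := by positivity
    calc _ ≤ Real.exp (-(d : ℝ)) * (Real.exp d * (β / (2 * Real.pi)) ^ ((d : ℝ) / 2)) := by
          gcongr
          exact a1.trans (mul_le_mul_of_nonneg_right a2 hN)
      _ = _ := by rw [← mul_assoc, ← Real.exp_add]; simp
  calc _ = (Real.exp (-(d : ℝ)) * (β' / (2 * Real.pi)) ^ ((d : ℝ) / 2)) / Real.sqrt Sig.det *
        Real.exp (-(β' / 2) * quadForm Sig (x - μ)) := by ring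
    _ ≤ _ := by gcongr

lemma euclNorm_compact {d : ℕ} (R : ℝ) : IsCompact {x : Fin d → ℝ | euclNorm x ≤ R} := by
  have hc : Continuous (fun x : Fin d → ℝ => euclNorm x) := by
    unfold euclNorm; fun_prop
  refine IsCompact.of_isClosed_subset (isCompact_Icc (a := fun _ => -R) (b := fun _ => R))
    (isClosed_le hc continuous_const) ?_
  intro x hx
  have hx' : euclNorm x ≤ R := hx
  have : ∀ k, |x k| ≤ R := fun k => by
    refine le_trans ?_ hx'
    unfold euclNorm
    rw [← Real.sqrt_sq_eq_abs]
    apply Real.sqrt_le_sqrt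
    exact Finset.single_le_sum (f := fun k => x k ^ 2) (fun _ _ => sq_nonneg _) (Finset.mem_univ k)
  exact ⟨fun k => (abs_le.1 (this k)).1, fun k => (abs_le.1 (this k)).2⟩

lemma vert_bound {d : ℕ} (Sig : Matrix (Fin d) (Fin d) ℝ) (hSig : Sig.PosDef) (β β' : ℝ)
    (hβ : 0 < β) (h1 : β ≤ β') (h2 : β' ≤ 2 * β) (μ : Fin d → ℝ) (X : Set (Fin d → ℝ))
    (hX : IsCompact X) (r r' rm P : ℝ) (hrm : 0 < rm) (hr : rm ≤ r) (hr' : rm ≤ r') (hP : 0 < P)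
    (hP' : 3 / 4 ≤ ∫ x in X, gaussDens Sig β' μ x) :
    rm * Real.exp (-(d : ℝ)) * (3 / 4) / (P * r) ≤
      ∫ x in X, (gaussDens Sig β μ x / P) *
        min ((r' * gaussDens Sig β' μ x) / (r * gaussDens Sig β μ x)) 1 := by
  have c1 := gaussDens_continuous Sig β μ
  have c2 := gaussDens_continuous Sig β' μ
  have p1 := gaussDens_pos Sig hSig β hβ μ
  have p2 := gaussDens_pos Sig hSig β' (by linarith) μ
  have hr0 : 0 < r := by linarith
  have hexp1 : Real.exp (-(d : ℝ)) ≤ 1 := Real.exp_le_one_iff.2 (by simp)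
  have hexp0 := Real.exp_pos (-(d : ℝ))
  calc _ ≤ rm * Real.exp (-(d : ℝ)) / (P * r) * ∫ x in X, gaussDens Sig β' μ x := by
        rw [mul_div_right_comm]; gcongr
    _ = ∫ x in X, rm * Real.exp (-(d : ℝ)) / (P * r) * gaussDens Sig β' μ x := by
        rw [integral_const_mul]
    _ ≤ _ := by
        apply setIntegral_mono_on
        · exact (c2.const_mul _).continuousOn.integrableOn_compact hX
        · refine Continuous.continuousOn ?_ |>.integrableOn_compact hX
          refine (c1.div_const _).mul (Continuous.min ?_ continuous_const)
          exact (c2.const_mul _).div (c1.const_mul _) fun x => (mul_pos hr0 (p1 x)).ne'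
        · exact hX.measurableSet
        · intro x _
          have hp1 := p1 x
          have hp2 := p2 x
          have e : (gaussDens Sig β μ x / P) *
              min ((r' * gaussDens Sig β' μ x) / (r * gaussDens Sig β μ x)) 1 =
              min (r' * gaussDens Sig β' μ x) (r * gaussDens Sig β μ x) / (P * r) := by
            rw [mul_min_of_nonneg _ _ (by positivity), ← min_div_div_right (by positivity)]
            congr 1 <;> field_simp
          rw [e, div_mul_eq_mul_div]
          gcongr
          have := gaussDens_ratio Sig hSig β β' hβ h1 h2 μ x
          apply le_min
          · apply mul_le_mul_of_nonneg_right _ hp2.le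
            nlinarith
          · rw [mul_assoc]
            exact mul_le_mul hr this (by positivity) hr0.le

lemma horiz_bound {d n : ℕ} (hd : 0 < d) (Sig : Matrix (Fin d) (Fin d) ℝ) (hSig : Sig.PosDef)
    (γmax γmin : ℝ) (hγ0 : 0 < γmin) (hγM0 : 0 < γmax)
    (hγmax : γmax ∈ upperBounds (Set.range hSig.isHermitian.eigenvalues))
    (hγmin : γmin ∈ lowerBounds (Set.range hSig.isHermitian.eigenvalues))
    (c₁ c₂ β D R P : ℝ) (hc₁ : 0 < c₁) (hc₂ : 0 < c₂) (hD : 0 < D) (hP : 0 < P)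
    (hlo : c₁ * γmin / D ^ 2 < β) (hhi : β < c₂ * γmin / D ^ 2)
    (hRD : Real.sqrt d * D ≤ R)
    (μ : Fin n → Fin d → ℝ) (hμ : ∀ k, ∑ l, μ k l ^ 2 ≤ D ^ 2)
    (w : Fin n → ℝ) (hw : ∀ j, 0 < w j) (hw1 : ∑ j, w j = 1) (j j' : Fin n) :
    w j' / P * ((2 * c₁ / Real.pi * (γmin / γmax)) ^ ((d : ℝ) / 2) * Real.exp (-(4 * c₂ * d))) ≤
      ∫ x in {x : Fin d → ℝ | euclNorm x ≤ R}, (gaussDens Sig β (μ j) x / P) *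
        (w j' * gaussDens Sig β (μ j') x / ∑ k, w k * gaussDens Sig β (μ k) x) := by
  have hβ : 0 < β := lt_trans (by positivity) hlo
  have hs := Real.sqrt_pos.2 hSig.det_pos
  have cont := fun k => gaussDens_continuous Sig β (μ k)
  have pos := fun k => gaussDens_pos Sig hSig β hβ (μ k)
  have hne : (Finset.univ : Finset (Fin n)).Nonempty := ⟨j, Finset.mem_univ _⟩
  have dpos : ∀ x, 0 < ∑ k, w k * gaussDens Sig β (μ k) x := fun x =>
    Finset.sum_pos (fun k _ => mul_pos (hw k) (pos k x)) hne
  set N := (β / (2 * Real.pi)) ^ ((d : ℝ) / 2) / Real.sqrt Sig.det with hN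
  have hNpos : 0 < N := by positivity
  have hub : ∀ k x, gaussDens Sig β (μ k) x ≤ N := fun k x => by
    have hq := quadForm_nonneg Sig hSig (x - μ k)
    unfold gaussDens
    apply mul_le_of_le_one_right hNpos.le
    apply Real.exp_le_one_iff.2
    nlinarith
  have dle : ∀ x, ∑ k, w k * gaussDens Sig β (μ k) x ≤ N := fun x => by
    calc _ ≤ ∑ k, w k * N := Finset.sum_le_sum fun k _ =>
          mul_le_mul_of_nonneg_left (hub k x) (hw k).le
      _ = N := by rw [← Finset.sum_mul, hw1, one_mul]
  have hd1 : (1 : ℝ) ≤ d := by exact_mod_cast hd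
  set C : Set (Fin d → ℝ) := Set.Icc (fun _ => -D) (fun _ => D) with hC
  have hxC : ∀ x ∈ C, ∑ l, x l ^ 2 ≤ d * D ^ 2 := by
    intro x hx
    calc ∑ l, x l ^ 2 ≤ ∑ _l : Fin d, D ^ 2 := Finset.sum_le_sum fun l _ => by
          have h1 := hx.1 l
          have h2 := hx.2 l
          exact sq_le_sq' h1 h2
      _ = d * D ^ 2 := by simp
  have hlb : ∀ k, ∀ x ∈ C, N * Real.exp (-(2 * c₂ * d)) ≤ gaussDens Sig β (μ k) x := by
    intro k x hx
    have hq := quadForm_le Sig hSig γmin hγ0 hγmin (x - μ k)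
    have hsum : ∑ l, (x - μ k) l ^ 2 ≤ 4 * d * D ^ 2 := by
      calc ∑ l, (x - μ k) l ^ 2 ≤ ∑ l, (2 * x l ^ 2 + 2 * μ k l ^ 2) :=
            Finset.sum_le_sum fun l _ => by
              simp only [Pi.sub_apply]
              nlinarith [sq_nonneg (x l + μ k l)]
        _ = 2 * ∑ l, x l ^ 2 + 2 * ∑ l, μ k l ^ 2 := by
            rw [Finset.sum_add_distrib, Finset.mul_sum, Finset.mul_sum]
        _ ≤ _ := by
            have := hxC x hx
            have := hμ k
            nlinarith [sq_nonneg D]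
    have hq2 : quadForm Sig (x - μ k) ≤ 4 * d * D ^ 2 / γmin :=
      hq.trans (by gcongr)
    unfold gaussDens
    apply mul_le_mul_of_nonneg_left _ hNpos.le
    apply Real.exp_le_exp.2
    have : β * quadForm Sig (x - μ k) ≤ c₂ * γmin / D ^ 2 * (4 * d * D ^ 2 / γmin) :=
      mul_le_mul hhi.le hq2 (quadForm_nonneg Sig hSig _) (by positivity)
    have e : c₂ * γmin / D ^ 2 * (4 * d * D ^ 2 / γmin) = 4 * c₂ * d := by field_simp
    rw [e] at this
    linarith
  have hCX : C ⊆ {x : Fin d → ℝ | euclNorm x ≤ R} := by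
    intro x hx
    refine le_trans ?_ hRD
    unfold euclNorm
    calc Real.sqrt (∑ k, x k ^ 2) ≤ Real.sqrt (d * D ^ 2) := Real.sqrt_le_sqrt (hxC x hx)
      _ = _ := by rw [Real.sqrt_mul (by positivity), Real.sqrt_sq hD.le]
  set f : (Fin d → ℝ) → ℝ := fun x => (gaussDens Sig β (μ j) x / P) *
        (w j' * gaussDens Sig β (μ j') x / ∑ k, w k * gaussDens Sig β (μ k) x) with hf
  have hfc : Continuous f := by
    refine ((cont j).div_const _).mul (((cont j').const_mul _).div ?_ fun x => (dpos x).ne')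
    exact continuous_finsetSum _ fun k _ => (cont k).const_mul _
  have hf0 : ∀ x, 0 ≤ f x := fun x => by
    have := pos j x
    have := pos j' x
    have := dpos x
    have := hw j'
    simp only [hf]
    positivity
  have hXc := euclNorm_compact (d := d) R
  have hCc : IsCompact C := isCompact_Icc
  have hvol : (volume.real C) = (2 * D) ^ d := by
    rw [hC, Measure.real, Real.volume_Icc_pi_toReal (fun _ => by linarith)]
    simp; ring
  have hfl : ∀ x ∈ C, w j' / P * (N * Real.exp (-(4 * c₂ * d))) ≤ f x := by
    intro x hx
    have a1 := hlb j x hx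
    have a2 := hlb j' x hx
    have a3 := dle x
    have a4 := dpos x
    have a5 := hw j'
    have e : w j' / P * (N * Real.exp (-(4 * c₂ * d))) =
        (N * Real.exp (-(2 * c₂ * d)) / P) * (w j' * (N * Real.exp (-(2 * c₂ * d))) / N) := by
      have : Real.exp (-(4 * c₂ * d)) = Real.exp (-(2 * c₂ * d)) * Real.exp (-(2 * c₂ * d)) := by
        rw [← Real.exp_add]; congr 1; ring
      rw [this]; field_simp
    rw [e]
    simp only [hf]
    have := pos j x
    have := pos j' x
    gcongr
  have hNvol : (2 * c₁ / Real.pi * (γmin / γmax)) ^ ((d : ℝ) / 2) ≤ N * (2 * D) ^ d := by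
    have b1 : Real.sqrt Sig.det ≤ γmax ^ ((d : ℝ) / 2) := by
      calc Real.sqrt Sig.det ≤ Real.sqrt (γmax ^ d) :=
            Real.sqrt_le_sqrt (det_le_pow Sig hSig γmax hγmax)
        _ = _ := by
            rw [Real.sqrt_eq_rpow, ← Real.rpow_natCast, ← Real.rpow_mul hγM0.le]
            congr 1; ring
    have b2 : (2 * D) ^ d = (4 * D ^ 2) ^ ((d : ℝ) / 2) := by
      have : (4 * D ^ 2) = (2 * D) ^ (2 : ℝ) := by
        rw [Real.rpow_two]; ring
      rw [this, ← Real.rpow_mul (by positivity), ← Real.rpow_natCast]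
      congr 1; ring
    calc (2 * c₁ / Real.pi * (γmin / γmax)) ^ ((d : ℝ) / 2)
        = (c₁ * γmin / D ^ 2 / (2 * Real.pi) / γmax * (4 * D ^ 2)) ^ ((d : ℝ) / 2) := by
          congr 1; field_simp; ring
      _ = (c₁ * γmin / D ^ 2 / (2 * Real.pi)) ^ ((d : ℝ) / 2) / γmax ^ ((d : ℝ) / 2)
            * (4 * D ^ 2) ^ ((d : ℝ) / 2) := by
          rw [Real.mul_rpow (by positivity) (by positivity),
            Real.div_rpow (by positivity) (by positivity)]
      _ ≤ N * (2 * D) ^ d := by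
          rw [b2, hN]
          gcongr
  have hwj := hw j'
  calc _ ≤ w j' / P * (N * Real.exp (-(4 * c₂ * d))) * (2 * D) ^ d := by
        have : w j' / P * (N * Real.exp (-(4 * c₂ * d))) * (2 * D) ^ d =
          w j' / P * ((N * (2 * D) ^ d) * Real.exp (-(4 * c₂ * d))) := by ring
        rw [this]
        gcongr
    _ = ∫ _x in C, w j' / P * (N * Real.exp (-(4 * c₂ * d))) := by
        rw [setIntegral_const, hvol, smul_eq_mul, mul_comm]
    _ ≤ ∫ x in C, f x := by
        apply setIntegral_mono_on
        · exact continuous_const.continuousOn.integrableOn_compact hCc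
        · exact hfc.continuousOn.integrableOn_compact hCc
        · exact hCc.measurableSet
        · exact hfl
    _ ≤ ∫ x in {x : Fin d → ℝ | euclNorm x ≤ R}, f x := by
        apply setIntegral_mono_set
        · exact hfc.continuousOn.integrableOn_compact hXc
        · exact Filter.Eventually.of_forall hf0
        · exact hCX.eventuallyLE

set_option maxHeartbeats 1000000 in
theorem stmt13 :
    ∀ c₁ c₂ : ℝ, 0 < c₁ → 0 < c₂ →
    ∃ c : ℝ, 0 < c ∧
      ∀ (d L n : ℕ) (hd : 0 < d) (hL : 2 ≤ L) (hn : 0 < n)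
        (lam : ℝ) (hlam : lam ∈ Set.Ioo (0 : ℝ) 1)
        (μ : Fin n → Fin d → ℝ)
        (Sig : Matrix (Fin d) (Fin d) ℝ) (hSig : Sig.PosDef)
        (γmax γmin : ℝ)
        (hγmax : IsGreatest (Set.range hSig.isHermitian.eigenvalues) γmax)
        (hγmin : IsLeast (Set.range hSig.isHermitian.eigenvalues) γmin)
        (w : Fin n → ℝ) (hw : ∀ j, 0 < w j) (hw1 : ∑ j, w j = 1)
        (β : Fin L → ℝ) (hβmono : StrictMono β) (hβ0pos : 0 < β ⟨0, by omega⟩)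
        (hβlast : β ⟨L - 1, by omega⟩ = 1)
        (rr : Fin L → ℝ) (hrr : ∀ i, 0 < rr i) (hrr1 : ∑ i, rr i = 1)
        (R D : ℝ) (hR : 0 < R)
        (hD : D = max (sSup (Set.range fun k => euclNorm (μ k))) (Real.sqrt γmin))
        -- `X⁰ = {x : ‖x‖ ≤ R}` and the component masses `P̃_{(i,j)}(X⁰)`
        (X0 : Set (Fin d → ℝ)) (hX0 : X0 = {x | euclNorm x ≤ R})
        (PtX0 : Fin L → Fin n → ℝ)
        (hPtX0 : ∀ i j, PtX0 i j = ∫ x in X0, gaussDens Sig (β i) (μ j) x)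
        -- condition (i)
        (hRD : Real.sqrt d * D ≤ R)
        (hmass : ∀ i j, 3 / 4 ≤ PtX0 i j)
        -- condition (ii)
        (hβ1lo : c₁ * γmin / D ^ 2 < β ⟨0, by omega⟩)
        (hβ1hi : β ⟨0, by omega⟩ < c₂ * γmin / D ^ 2)
        (hβ1le1 : β ⟨0, by omega⟩ ≤ 1)
        -- condition (iii)
        (hβratio : ∀ (i : Fin L) (h : (i : ℕ) + 1 < L),
          β ⟨(i : ℕ) + 1, h⟩ / β i ≤ 1 + 1 / Real.sqrt d)
        -- the projected chain
        (Moff : Fin L × Fin n → Fin L × Fin n → ℝ)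
        (hMoff : ∀ a b, Moff a b =
          if a.1 = b.1 ∧ a.2 ≠ b.2 then
            (1 - lam) * ∫ x in X0, (gaussDens Sig (β a.1) (μ a.2) x / PtX0 a.1 a.2) *
              (w b.2 * gaussDens Sig (β a.1) (μ b.2) x /
                ∑ k, w k * gaussDens Sig (β a.1) (μ k) x)
          else if adjacent a.1 b.1 ∧ a.2 = b.2 then
            (lam / 2) * ∫ x in X0, (gaussDens Sig (β a.1) (μ a.2) x / PtX0 a.1 a.2) *
              min ((rr b.1 * gaussDens Sig (β b.1) (μ a.2) x) /
                (rr a.1 * gaussDens Sig (β a.1) (μ a.2) x)) 1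
          else 0)
        (Mhat : Fin L × Fin n → Fin L × Fin n → ℝ)
        (hMhat : ∀ a b, Mhat a b =
          if a = b then 1 - ∑ e ∈ Finset.univ.erase a, Moff a e else Moff a b)
        -- its stationary distribution
        (Phat : Fin L × Fin n → ℝ)
        (hPhat : ∀ a, Phat a = rr a.1 * w a.2 * PtX0 a.1 a.2 /
          ∑ b : Fin L × Fin n, rr b.1 * w b.2 * PtX0 b.1 b.2),
        -- conclusion: Poincaré inequality for the projected chain
        ∀ ghat : Fin L × Fin n → ℝ,
          (1 / 2) * ∑ a : Fin L × Fin n, ∑ b : Fin L × Fin n,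
              (ghat b - ghat a) ^ 2 * Phat a * Phat b
            ≤ (64 * L ^ 2 * (γmax / γmin) ^ ((d : ℝ) / 2) * Real.exp (c * d) /
                (3 * min (1 - lam) lam * ((⨅ i, rr i) / (⨆ i, rr i)) ^ 2)) *
              ((1 / 2) * ∑ a : Fin L × Fin n, ∑ b : Fin L × Fin n,
                (ghat b - ghat a) ^ 2 * Phat a * Mhat a b) := by
  intro c₁ c₂ hc₁ hc₂
  refine ⟨4 * c₂ + 1 + |Real.log (2 * c₁ / Real.pi)| / 2, by positivity, ?_⟩
  intro d L n hd hL hn lam hlam μ Sig hSig γmax γmin hγmax hγmin w hw hw1 β hβmono hβ0pos hβlast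
    rr hrr hrr1 R D hR hD X0 hX0 PtX0 hPtX0 hRD hmass hβ1lo hβ1hi hβ1le1 hβratio Moff hMoff
    Mhat hMhat Phat hPhat g
  set c := 4 * c₂ + 1 + |Real.log (2 * c₁ / Real.pi)| / 2 with hc
  obtain ⟨hlam0, hlam1⟩ := hlam
  have hγ0 : 0 < γmin := by
    obtain ⟨i, hi⟩ := hγmin.1
    rw [← hi]; exact hSig.eigenvalues_pos i
  have hγle : γmin ≤ γmax := hγmin.2 hγmax.1
  have hγM0 : 0 < γmax := by linarith
  have hDpos : 0 < D := by
    rw [hD]; exact lt_max_of_lt_right (Real.sqrt_pos.2 hγ0)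
  have hμ : ∀ k, ∑ l, μ k l ^ 2 ≤ D ^ 2 := by
    intro k
    have h1 : euclNorm (μ k) ≤ D := by
      rw [hD]
      exact le_max_of_le_left (le_csSup (Set.finite_range _).bddAbove ⟨k, rfl⟩)
    unfold euclNorm at h1
    exact (Real.sqrt_le_left hDpos.le).1 h1
  have hβpos : ∀ i, 0 < β i := fun i =>
    lt_of_lt_of_le hβ0pos (hβmono.monotone (Fin.mk_le_of_le_val (Nat.zero_le _)))
  have hXc : IsCompact X0 := by rw [hX0]; exact euclNorm_compact R
  have hP1 : ∀ i j, PtX0 i j ≤ 1 := by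
    intro i j
    obtain ⟨h1, h2⟩ := gaussDens_integral Sig hSig (β i) (hβpos i) (μ j)
    rw [hPtX0, ← h2]
    exact setIntegral_le_integral h1
      (Filter.Eventually.of_forall fun x => (gaussDens_pos Sig hSig _ (hβpos i) _ x).le)
  have hPpos : ∀ i j, 0 < PtX0 i j := fun i j => by have := hmass i j; linarith
  have : Nonempty (Fin L) := ⟨⟨0, by omega⟩⟩
  set rm := ⨅ i, rr i with hrm
  set rM := ⨆ i, rr i with hrM
  have hrmle : ∀ i, rm ≤ rr i := fun i => ciInf_le (Set.finite_range rr).bddBelow i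
  have hrMge : ∀ i, rr i ≤ rM := fun i => le_ciSup (Set.finite_range rr).bddAbove i
  have hrm0 : 0 < rm := by
    obtain ⟨i, hi⟩ := exists_eq_ciInf_of_finite (f := rr)
    rw [hrm, ← hi]; exact hrr i
  have hrM0 : 0 < rM := lt_of_lt_of_le (hrr ⟨0, by omega⟩) (hrMge _)
  have hrmM : rm ≤ rM := (hrmle ⟨0, by omega⟩).trans (hrMge _)
  have hLrM : 1 ≤ L * rM := by
    calc (1 : ℝ) = ∑ i, rr i := hrr1.symm
      _ ≤ ∑ _i : Fin L, rM := Finset.sum_le_sum fun i _ => hrMge i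
      _ = L * rM := by simp
  set Z := ∑ b : Fin L × Fin n, rr b.1 * w b.2 * PtX0 b.1 b.2 with hZ
  have hZpos : 0 < Z := by
    rw [hZ]
    refine Finset.sum_pos (fun b _ => mul_pos (mul_pos (hrr _) (hw _)) (hPpos _ _))
      ⟨(⟨0, by omega⟩, ⟨0, hn⟩), Finset.mem_univ _⟩
  set m := min (1 - lam) lam with hm
  have hm0 : 0 < m := lt_min (by linarith) hlam0
  have hm1 : m ≤ 1 - lam := min_le_left _ _
  have hm2 : m ≤ lam := min_le_right _ _
  set K := (γmax / γmin) ^ ((d : ℝ) / 2) with hK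
  have hK0 : 0 < K := by positivity
  have hK1 : 1 ≤ K := Real.one_le_rpow ((one_le_div hγ0).2 hγle) (by positivity)
  set eta := (K * Real.exp (c * d))⁻¹ with heta
  have heta0 : 0 < eta := by positivity
  have hd0 : (0 : ℝ) ≤ d := by positivity
  have heta' : eta = K⁻¹ * Real.exp (-(c * d)) := by
    rw [heta, mul_inv, Real.exp_neg]
  have heta1 : eta ≤ Real.exp (-(d : ℝ)) := by
    rw [heta']
    have h1 : K⁻¹ ≤ 1 := inv_le_one_of_one_le₀ hK1
    have h2 : Real.exp (-(c * d)) ≤ Real.exp (-(d : ℝ)) := by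
      apply Real.exp_le_exp.2
      have : 1 ≤ c := by
        rw [hc]
        have := abs_nonneg (Real.log (2 * c₁ / Real.pi))
        linarith
      nlinarith
    calc _ ≤ 1 * Real.exp (-(d : ℝ)) := by gcongr
      _ = _ := one_mul _
  have heta2 : eta ≤ (2 * c₁ / Real.pi * (γmin / γmax)) ^ ((d : ℝ) / 2) *
      Real.exp (-(4 * c₂ * d)) := by
    have e1 : (γmin / γmax) ^ ((d : ℝ) / 2) = K⁻¹ := by
      rw [hK, ← Real.inv_rpow (by positivity), inv_div]
    have hx : 0 < 2 * c₁ / Real.pi := by positivity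
    rw [Real.mul_rpow (by positivity) (by positivity), e1, heta', Real.rpow_def_of_pos hx]
    have : Real.exp (-(c * d)) ≤ Real.exp (Real.log (2 * c₁ / Real.pi) * ((d : ℝ) / 2)) *
        Real.exp (-(4 * c₂ * d)) := by
      rw [← Real.exp_add]
      apply Real.exp_le_exp.2
      have := neg_abs_le (Real.log (2 * c₁ / Real.pi))
      rw [hc]
      nlinarith
    calc _ ≤ K⁻¹ * (Real.exp (Real.log (2 * c₁ / Real.pi) * ((d : ℝ) / 2)) *
        Real.exp (-(4 * c₂ * d))) := by gcongr
      _ = _ := by ring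
  set al := m * rm * (3 / 8) * eta with hal
  have hal0 : 0 < al := by positivity
  have hMne : ∀ a b, a ≠ b → Mhat a b = Moff a b := fun a b h => by
    rw [hMhat, if_neg h]
  have hgp : ∀ i k x, 0 < gaussDens Sig (β i) (μ k) x := fun i k x =>
    gaussDens_pos Sig hSig _ (hβpos i) _ x
  have hMoff0 : ∀ a b, 0 ≤ Moff a b := by
    intro a b
    rw [hMoff]
    split_ifs
    · refine mul_nonneg (by linarith) (integral_nonneg fun x => ?_)
      refine mul_nonneg (div_nonneg (hgp _ _ _).le (hPpos _ _).le) (div_nonneg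
        (mul_nonneg (hw _).le (hgp _ _ _).le) ?_)
      exact Finset.sum_nonneg fun k _ => mul_nonneg (hw _).le (hgp _ _ _).le
    · refine mul_nonneg (by linarith) (integral_nonneg fun x => ?_)
      refine mul_nonneg (div_nonneg (hgp _ _ _).le (hPpos _ _).le) (le_min (div_nonneg
        (mul_nonneg (hrr _).le (hgp _ _ _).le) (mul_nonneg (hrr _).le (hgp _ _ _).le)) zero_le_one)
    · exact le_rfl
  have main := chain_bound L n hL rr w PtX0 hrr hrr1 hw hw1 hmass hP1 Z hZ Phat hPhat Mhat al hal0
    (fun a b h => by rw [hMne a b h]; exact hMoff0 a b)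
    (by
      rintro ⟨i, j⟩ ⟨i', j'⟩ h1 h2
      dsimp only at h1 h2
      subst h2
      have hne : i ≠ i' := fun h => by rw [h] at h1; omega
      have hne2 : (i, j) ≠ (i', j) := fun h => hne (congrArg Prod.fst h)
      rw [hMne _ _ hne2, hMoff, if_neg (fun h => hne h.1), if_pos ⟨Or.inl h1, rfl⟩, hPhat]
      dsimp only
      have hlt : (i : ℕ) + 1 < L := h1 ▸ i'.2
      have hi' : i' = ⟨(i : ℕ) + 1, hlt⟩ := Fin.ext h1
      have hrat := hβratio i hlt
      rw [← hi'] at hrat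
      have hb2 : β i' ≤ 2 * β i := by
        have hs : 1 / Real.sqrt d ≤ 1 := by
          rw [div_le_one (Real.sqrt_pos.2 (by exact_mod_cast hd))]
          rw [Real.one_le_sqrt]
          exact_mod_cast hd
        rw [div_le_iff₀ (hβpos i)] at hrat
        have := hβpos i
        nlinarith
      have hb1 : β i ≤ β i' := hβmono.monotone (by rw [Fin.le_def]; omega)
      have hv := vert_bound Sig hSig (β i) (β i') (hβpos i) hb1 hb2 (μ j) X0 hXc (rr i) (rr i') rm
        (PtX0 i j) hrm0 (hrmle i) (hrmle i') (hPpos i j) (by rw [← hPtX0]; exact hmass i' j)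
      have hPij := hPpos i j
      have hri := hrr i
      have hwj := hw j
      calc w j * al / Z ≤ w j * (lam * rm * (3 / 8) * Real.exp (-(d : ℝ))) / Z := by
            rw [hal]; gcongr
        _ = rr i * w j * PtX0 i j / Z * (lam / 2 *
              (rm * Real.exp (-(d : ℝ)) * (3 / 4) / (PtX0 i j * rr i))) := by
            field_simp; ring
        _ ≤ _ := mul_le_mul_of_nonneg_left (mul_le_mul_of_nonneg_left hv (by linarith))
            (div_nonneg (mul_pos (mul_pos hri hwj) hPij).le hZpos.le))
    (by
      rintro ⟨i, j⟩ ⟨i', j'⟩ h1 h2 h3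
      dsimp only at h1 h2 h3
      have hi : i = ⟨0, by omega⟩ := Fin.ext h1
      have hii : i = i' := Fin.ext (by rw [h1, h2])
      subst hii
      have hne2 : (i, j) ≠ (i, j') := fun h => h3 (congrArg Prod.snd h)
      rw [hMne _ _ hne2, hMoff, if_pos ⟨rfl, h3⟩, hPhat]
      dsimp only
      have hh := horiz_bound hd Sig hSig γmax γmin hγ0 hγM0 hγmax.2 hγmin.2 c₁ c₂ (β i) D R
        (PtX0 i j) hc₁ hc₂ hDpos (hPpos i j) (by rw [hi]; exact hβ1lo) (by rw [hi]; exact hβ1hi)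
        hRD μ hμ w hw hw1 j j'
      rw [← hX0] at hh
      have hPij := hPpos i j
      have hri := hrr i
      have hwj := hw j
      have hwj' := hw j'
      have hrmi := hrmle i
      have h1l : 0 < 1 - lam := by linarith
      have hh2 : w j' / PtX0 i j * eta ≤ _ := le_trans (by gcongr) hh
      calc w j * w j' * al / Z ≤ w j * w j' * ((1 - lam) * rr i * 1 * eta) / Z := by
            rw [hal]; gcongr; norm_num
        _ = rr i * w j * PtX0 i j / Z * ((1 - lam) * (w j' / PtX0 i j * eta)) := by
            field_simp
        _ ≤ _ := mul_le_mul_of_nonneg_left (mul_le_mul_of_nonneg_left hh2 (by linarith))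
            (div_nonneg (mul_pos (mul_pos hri hwj) hPij).le hZpos.le))
    g
  have hV0 : 0 ≤ (1 / 2) * ∑ a, ∑ b, (g b - g a) ^ 2 * Phat a * Phat b := by
    have hp0 : ∀ a, 0 ≤ Phat a := fun a => by
      rw [hPhat]
      exact div_nonneg (mul_pos (mul_pos (hrr _) (hw _)) (hPpos _ _)).le hZpos.le
    refine mul_nonneg (by norm_num) (Finset.sum_nonneg fun a _ => Finset.sum_nonneg fun b _ => ?_)
    exact mul_nonneg (mul_nonneg (sq_nonneg _) (hp0 a)) (hp0 b)
  have hL0 : (0 : ℝ) < L := by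
    have : 0 < L := by omega
    exact_mod_cast this
  refine main.trans (mul_le_mul_of_nonneg_right ?_ ?_)
  · have e1 : 6 * L / al = 16 * L / (m * rm) * (K * Real.exp (c * d)) := by
      rw [hal, heta]; field_simp; norm_num
    have e2 : 64 * L ^ 2 * K * Real.exp (c * d) / (3 * m * (rm / rM) ^ 2) =
        64 / 3 * L ^ 2 / (m * (rm / rM) ^ 2) * (K * Real.exp (c * d)) := by
      field_simp
    rw [e1, e2]
    refine mul_le_mul_of_nonneg_right ?_ (by positivity)
    rw [div_le_div_iff₀ (by positivity) (by positivity)]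
    have h1 : (rm / rM) ^ 2 ≤ L * rm := by
      have a1 : rm / rM ≤ 1 := (div_le_one hrM0).2 hrmM
      have a2 : 0 ≤ rm / rM := by positivity
      have a3 : rm / rM ≤ L * rm := by
        rw [div_le_iff₀ hrM0]; nlinarith
      nlinarith
    calc 16 * L * (m * (rm / rM) ^ 2) ≤ 16 * L * (m * (L * rm)) := by gcongr
      _ = 16 * L ^ 2 * (m * rm) := by ring
      _ ≤ 64 / 3 * L ^ 2 * (m * rm) := by gcongr; norm_num
  · by_contra hneg
    push Not at hneg
    have : 6 * L / al * ((1 / 2) * ∑ a, ∑ b, (g b - g a) ^ 2 * Phat a * Mhat a b) < 0 :=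
      mul_neg_of_pos_of_neg (by positivity) hneg
    linarith
end
end

section
/- Let f(x) = −log(∑_{j=1}^n w_j exp(−(1/2)(x−μ_j)ᵀΣ⁻¹(x−μ_j))) and p*₁(x) ∝ exp(−β₁ f(x)). Let the initial distribution P⁰ on [L]×ℝ^d place all mass on level 1 with density N(0, σ₀²I), and let P be the distribution on [L]×ℝ^d with density p(i,x) = r_i p*_i(x), where r₁ > 0. Suppose 0 < s₁ ≤ s₂ < 2 and s₃ > 0 are constants with s₁γ_min/β₁ ≤ σ₀² ≤ s₂γ_min/β₁ and β₁ ≤ s₃γ_min/D², where D = max{ max_k ‖μ_k‖, √γ_min }. Then f₀ := dP⁰/dP satisfies ‖f₀‖²_{L²(P)} ≤ ( κ^{d/2} s₂^{d/2} / ( s₁^d (2−s₂)^{d/2} r₁ w_min ) ) · exp( s₃/(2−s₂) ), where κ = γ_max/γ_min and w_min = min_j w_j. -/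
open MeasureTheory Matrix

noncomputable section

/-- The Gaussian mixture potential `f`. -/
def mixPotential {d n : ℕ} (Sig : Matrix (Fin d) (Fin d) ℝ) (μ : Fin n → Fin d → ℝ)
    (w : Fin n → ℝ) (x : Fin d → ℝ) : ℝ :=
  -Real.log (∑ j, w j * Real.exp (-(1 / 2) * quadForm Sig (x - μ j)))

/-- Density of the Gaussian distribution `N(0, σ₀² I)` on `ℝ^d`. -/
def isoGaussDens (d : ℕ) (σ0sq : ℝ) (x : Fin d → ℝ) : ℝ :=
  (2 * Real.pi * σ0sq) ^ (-(d : ℝ) / 2) * Real.exp (-(∑ k, x k ^ 2) / (2 * σ0sq))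

lemma quadForm_bounds {d : ℕ} (Sig : Matrix (Fin d) (Fin d) ℝ) (hSig : Sig.PosDef)
    (γmax γmin : ℝ)
    (hγmax : IsGreatest (Set.range hSig.isHermitian.eigenvalues) γmax)
    (hγmin : IsLeast (Set.range hSig.isHermitian.eigenvalues) γmin) (v : Fin d → ℝ) :
    (∑ k, v k ^ 2) / γmax ≤ quadForm Sig v ∧ quadForm Sig v ≤ (∑ k, v k ^ 2) / γmin := by
  have hpos : ∀ i, 0 < hSig.isHermitian.eigenvalues i := fun i => hSig.eigenvalues_pos i
  set l := hSig.isHermitian.eigenvalues with hl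
  set U : Matrix (Fin d) (Fin d) ℝ := (hSig.isHermitian.eigenvectorUnitary : Matrix (Fin d) (Fin d) ℝ) with hU
  have hUU : U * Uᵀ = 1 := by
    have := Unitary.coe_mul_star_self hSig.isHermitian.eigenvectorUnitary
    simpa [Matrix.star_eq_conjTranspose] using this
  have hUU' : Uᵀ * U = 1 := by
    have := Unitary.coe_star_mul_self hSig.isHermitian.eigenvectorUnitary
    simpa [Matrix.star_eq_conjTranspose] using this
  have hS : Sig = U * diagonal l * Uᵀ := by
    have := hSig.isHermitian.spectral_theorem
    rw [Unitary.conjStarAlgAut_apply] at this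
    simpa [Matrix.star_eq_conjTranspose, Function.comp_def] using this
  have hdd : diagonal l * diagonal (fun i => (l i)⁻¹) = 1 := by
    rw [diagonal_mul_diagonal, ← diagonal_one]
    congr 1; funext i; exact mul_inv_cancel₀ (hpos i).ne'
  have hinv : Sig⁻¹ = U * diagonal (fun i => (l i)⁻¹) * Uᵀ := by
    apply Matrix.inv_eq_right_inv
    calc Sig * (U * diagonal (fun i => (l i)⁻¹) * Uᵀ)
        = U * diagonal l * (Uᵀ * U) * diagonal (fun i => (l i)⁻¹) * Uᵀ := by
          rw [hS]; simp only [Matrix.mul_assoc]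
      _ = U * (diagonal l * diagonal (fun i => (l i)⁻¹)) * Uᵀ := by
          rw [hUU']; simp only [Matrix.mul_assoc, Matrix.one_mul]
      _ = 1 := by rw [hdd, Matrix.mul_one, hUU]
  set z := Uᵀ *ᵥ v with hz
  have hq : quadForm Sig v = ∑ i, (l i)⁻¹ * z i ^ 2 := by
    unfold quadForm
    rw [hinv, ← Matrix.mulVec_mulVec, ← Matrix.mulVec_mulVec, Matrix.dotProduct_mulVec,
      ← Matrix.mulVec_transpose, ← hz]
    simp only [dotProduct, mulVec_diagonal]
    exact Finset.sum_congr rfl fun i _ => by ring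
  have hn : ∑ k, v k ^ 2 = ∑ i, z i ^ 2 := by
    have h1 : z ⬝ᵥ z = v ⬝ᵥ v := by
      conv_lhs => rw [hz, Matrix.dotProduct_mulVec, ← Matrix.mulVec_transpose,
        Matrix.transpose_transpose, Matrix.mulVec_mulVec, hUU, Matrix.one_mulVec]
    simpa [dotProduct, pow_two] using h1.symm
  obtain ⟨i0, hi0⟩ := hγmin.1
  have hgm : 0 < γmin := hi0 ▸ hpos i0
  rw [hq, hn, Finset.sum_div, Finset.sum_div]
  constructor <;> refine Finset.sum_le_sum fun i _ => ?_
  · rw [div_eq_inv_mul]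
    have := hγmax.2 ⟨i, rfl⟩
    gcongr
    exact hpos i
  · rw [div_eq_inv_mul]
    have := hγmin.2 ⟨i, rfl⟩
    gcongr

lemma gauss_int {d : ℕ} (a : ℝ) (ha : 0 < a) (c : Fin d → ℝ) :
    Integrable (fun x : Fin d → ℝ => Real.exp (-a * ∑ k, x k ^ 2 + ∑ k, c k * x k)) ∧
    ∫ x : Fin d → ℝ, Real.exp (-a * ∑ k, x k ^ 2 + ∑ k, c k * x k) =
      (Real.pi / a) ^ ((d : ℝ) / 2) * Real.exp ((∑ k, c k ^ 2) / (4 * a)) := by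
  have hb : 0 < (a : ℂ).re := by simpa using ha
  have h1 := GaussianFourier.integrable_cexp_neg_mul_sum_add hb (fun k => (c k : ℂ))
  have h2 := GaussianFourier.integral_cexp_neg_mul_sum_add hb (fun k => (c k : ℂ))
  have e : ∀ x : Fin d → ℝ, Complex.exp (-(a : ℂ) * ∑ k, (x k : ℂ) ^ 2 + ∑ k, (c k : ℂ) * x k) =
      ((Real.exp (-a * ∑ k, x k ^ 2 + ∑ k, c k * x k) : ℝ) : ℂ) := fun x => by push_cast; rfl
  simp only [e] at h1 h2
  refine ⟨h1.re, ?_⟩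
  rw [integral_complex_ofReal] at h2
  apply Complex.ofReal_injective
  rw [h2, Complex.ofReal_mul, Complex.ofReal_cpow (by positivity)]
  push_cast
  simp

lemma mix_bounds {n : ℕ} (hn : 0 < n) (w : Fin n → ℝ) (hw : ∀ j, 0 < w j) (hw1 : ∑ j, w j = 1)
    (q : Fin n → ℝ) (b : ℝ) (hb : 0 < b) :
    Real.exp (-b * -Real.log (∑ j, w j * Real.exp (-(1 / 2) * q j))) ≤
      (1 / ⨅ j, w j) * ∑ j, w j * Real.exp (-b * q j / 2) ∧
    1 / Real.exp (-b * -Real.log (∑ j, w j * Real.exp (-(1 / 2) * q j))) ≤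
      ∑ j, w j * Real.exp (b * q j / 2) := by
  have : Nonempty (Fin n) := ⟨⟨0, hn⟩⟩
  have hSpos : 0 < ∑ j, w j * Real.exp (-(1 / 2) * q j) :=
    Finset.sum_pos (fun j _ => mul_pos (hw j) (Real.exp_pos _)) Finset.univ_nonempty
  set S := ∑ j, w j * Real.exp (-(1 / 2) * q j) with hS
  have hwm : 0 < ⨅ j, w j := by
    obtain ⟨j, hj⟩ := exists_eq_ciInf_of_finite (f := w)
    rw [← hj]; exact hw j
  constructor
  · obtain ⟨j, -, hj⟩ : ∃ j ∈ Finset.univ, w j * S ≤ w j * Real.exp (-(1 / 2) * q j) := by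
      apply Finset.exists_le_of_sum_le Finset.univ_nonempty
      rw [← Finset.sum_mul, hw1, one_mul]
    have hj' := le_of_mul_le_mul_left hj (hw j)
    have hl : Real.log S ≤ -(1 / 2) * q j := (Real.log_le_iff_le_exp hSpos).2 hj'
    have h1 : Real.exp (-b * -Real.log S) ≤ Real.exp (-b * q j / 2) :=
      Real.exp_le_exp.2 (by nlinarith)
    have h2 : w j * Real.exp (-b * q j / 2) ≤ ∑ j, w j * Real.exp (-b * q j / 2) :=
      Finset.single_le_sum (f := fun j => w j * Real.exp (-b * q j / 2))
        (fun i _ => (mul_pos (hw i) (Real.exp_pos _)).le) (Finset.mem_univ j)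
    have h3 : (⨅ j, w j) ≤ w j := ciInf_le (Set.finite_range w).bddBelow j
    rw [one_div, ← div_eq_inv_mul, le_div_iff₀ hwm]
    calc _ ≤ Real.exp (-b * q j / 2) * w j := by gcongr
      _ ≤ _ := by rw [mul_comm]; exact h2
  · have hlog := (strictConcaveOn_log_Ioi.concaveOn).le_map_sum (t := Finset.univ) (w := w)
      (p := fun j => Real.exp (-(1 / 2) * q j)) (fun j _ => (hw j).le) hw1
      (fun j _ => Real.exp_pos _)
    simp only [smul_eq_mul, Real.log_exp] at hlog
    have hexp := convexOn_exp.map_sum_le (t := Finset.univ) (w := w)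
      (p := fun j => b * q j / 2) (fun j _ => (hw j).le) hw1 (fun j _ => Set.mem_univ _)
    simp only [smul_eq_mul] at hexp
    refine le_trans ?_ hexp
    rw [one_div, ← Real.exp_neg, Real.exp_le_exp]
    have e1 : ∑ j, w j * (b * q j / 2) = -b * ∑ j, w j * (-(1 / 2) * q j) := by
      rw [Finset.mul_sum]; exact Finset.sum_congr rfl fun j _ => by ring
    rw [e1]
    nlinarith

lemma Z_bound {d n : ℕ} (hn : 0 < n)
    (μ : Fin n → Fin d → ℝ)
    (Sig : Matrix (Fin d) (Fin d) ℝ) (hSig : Sig.PosDef)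
    (γmax γmin : ℝ)
    (hγmax : IsGreatest (Set.range hSig.isHermitian.eigenvalues) γmax)
    (hγmin : IsLeast (Set.range hSig.isHermitian.eigenvalues) γmin)
    (w : Fin n → ℝ) (hw : ∀ j, 0 < w j) (hw1 : ∑ j, w j = 1)
    (b : ℝ) (hb : 0 < b) (hM : 0 < γmax) (hwm : 0 < ⨅ j, w j) :
    ∫ x, Real.exp (-b * mixPotential Sig μ w x) ≤
      (1 / ⨅ j, w j) * (Real.pi / (b / (2 * γmax))) ^ ((d : ℝ) / 2) := by
  obtain ⟨hi, hv⟩ := gauss_int (d := d) (b / (2 * γmax)) (by positivity) 0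
  simp only [Pi.zero_apply, zero_mul, Finset.sum_const_zero, add_zero, ne_eq, OfNat.ofNat_ne_zero,
    not_false_eq_true, zero_pow, zero_div, Real.exp_zero, mul_one] at hi hv
  have hij : ∀ j, Integrable (fun x : Fin d → ℝ =>
      w j * Real.exp (-(b / (2 * γmax)) * ∑ k, (x - μ j) k ^ 2)) := fun j =>
    (hi.comp_sub_right (μ j)).const_mul (w j)
  have key : ∫ x : Fin d → ℝ, (1 / ⨅ j, w j) *
      ∑ j, w j * Real.exp (-(b / (2 * γmax)) * ∑ k, (x - μ j) k ^ 2) =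
      (1 / ⨅ j, w j) * (Real.pi / (b / (2 * γmax))) ^ ((d : ℝ) / 2) := by
    rw [integral_const_mul, integral_finsetSum _ (fun j _ => hij j)]
    congr 1
    have : ∀ j, ∫ x : Fin d → ℝ, w j * Real.exp (-(b / (2 * γmax)) * ∑ k, (x - μ j) k ^ 2) =
        w j * (Real.pi / (b / (2 * γmax))) ^ ((d : ℝ) / 2) := fun j => by
      rw [integral_const_mul, ← hv]
      congr 1
      exact integral_sub_right_eq_self
        (fun x : Fin d → ℝ => Real.exp (-(b / (2 * γmax)) * ∑ k, x k ^ 2)) (μ j)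
    simp only [this]
    rw [← Finset.sum_mul, hw1, one_mul]
  rw [← key]
  apply integral_mono_of_nonneg
  · exact Filter.Eventually.of_forall fun x => (Real.exp_pos _).le
  · exact (integrable_finsetSum _ (fun j _ => hij j)).const_mul _
  · refine Filter.Eventually.of_forall fun x => ?_
    refine (mix_bounds hn w hw hw1 (fun j => quadForm Sig (x - μ j)) b hb).1.trans ?_
    dsimp only
    gcongr with j _
    · exact (hw j).le
    have h := (quadForm_bounds Sig hSig γmax γmin hγmax hγmin (x - μ j)).1
    have e : -(b / (2 * γmax)) * ∑ k, (x - μ j) k ^ 2 =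
        -(b / 2) * ((∑ k, (x - μ j) k ^ 2) / γmax) := by field_simp
    rw [e]
    nlinarith

lemma cross_bound {d n : ℕ} (hn : 0 < n)
    (μ : Fin n → Fin d → ℝ)
    (Sig : Matrix (Fin d) (Fin d) ℝ) (hSig : Sig.PosDef)
    (γmax γmin : ℝ)
    (hγmax : IsGreatest (Set.range hSig.isHermitian.eigenvalues) γmax)
    (hγmin : IsLeast (Set.range hSig.isHermitian.eigenvalues) γmin)
    (w : Fin n → ℝ) (hw : ∀ j, 0 < w j) (hw1 : ∑ j, w j = 1)
    (b : ℝ) (hb : 0 < b) (hm : 0 < γmin) (σ s₂ s₃ : ℝ) (hσ : 0 < σ) (hs₂ : s₂ < 2)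
    (hσs : b / γmin * σ ≤ s₂) (hμ : ∀ j, b / γmin * ∑ k, μ j k ^ 2 ≤ s₃) (hs₃ : 0 < s₃) :
    ∫ x, isoGaussDens d σ x ^ 2 * (1 / Real.exp (-b * mixPotential Sig μ w x)) ≤
      ((2 * Real.pi * σ) ^ (-(d : ℝ) / 2)) ^ 2 *
      (Real.pi / (1 / σ - b / γmin / 2)) ^ ((d : ℝ) / 2) * Real.exp (s₃ / (2 - s₂)) := by
  set t := b / γmin with ht
  have ht0 : 0 < t := by positivity
  set a := 1 / σ - t / 2 with ha
  have ha' : a = (2 - t * σ) / (2 * σ) := by rw [ha]; field_simp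
  have ha0 : 0 < a := by rw [ha']; apply div_pos <;> linarith
  set C := ((2 * Real.pi * σ) ^ (-(d : ℝ) / 2)) ^ 2 with hC
  have hC0 : 0 ≤ C := by positivity
  have hi := fun j => (gauss_int a ha0 (fun k => -t * μ j k)).1
  have hv := fun j => (gauss_int a ha0 (fun k => -t * μ j k)).2
  let F : Fin n → (Fin d → ℝ) → ℝ := fun j x => (w j * C * Real.exp (t / 2 * ∑ k, μ j k ^ 2)) *
    Real.exp (-a * ∑ k, x k ^ 2 + ∑ k, -t * μ j k * x k)
  have hF : ∀ j, Integrable (F j) := fun j => (hi j).const_mul _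
  have hFv : ∀ j, ∫ x, F j x ≤ w j * (C * (Real.pi / a) ^ ((d : ℝ) / 2) *
      Real.exp (s₃ / (2 - s₂))) := fun j => by
    simp only [F]
    rw [integral_const_mul, hv j]
    have hexp : Real.exp (t / 2 * ∑ k, μ j k ^ 2) *
        Real.exp ((∑ k, (-t * μ j k) ^ 2) / (4 * a)) ≤ Real.exp (s₃ / (2 - s₂)) := by
      rw [← Real.exp_add, Real.exp_le_exp]
      have e1 : ∑ k, (-t * μ j k) ^ 2 = t ^ 2 * ∑ k, μ j k ^ 2 := by
        rw [Finset.mul_sum]; exact Finset.sum_congr rfl fun k _ => by ring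
      have h2 : 0 < 2 - t * σ := by linarith
      have e2 : t / 2 * ∑ k, μ j k ^ 2 + (∑ k, (-t * μ j k) ^ 2) / (4 * a) =
          (t * ∑ k, μ j k ^ 2) / (2 - t * σ) := by
        rw [e1, ha']; field_simp; ring
      rw [e2]
      have := hμ j
      apply div_le_div₀ hs₃.le this (by linarith) (by linarith)
    calc _ = w j * (C * (Real.pi / a) ^ ((d : ℝ) / 2) * (Real.exp (t / 2 * ∑ k, μ j k ^ 2) *
        Real.exp ((∑ k, (-t * μ j k) ^ 2) / (4 * a)))) := by ring
      _ ≤ _ := by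
        have := (hw j).le
        gcongr
  calc _ ≤ ∫ x, ∑ j, F j x := by
        apply integral_mono_of_nonneg
        · exact Filter.Eventually.of_forall fun x => by
            have := Real.exp_pos (-b * mixPotential Sig μ w x)
            dsimp only [Pi.zero_apply]
            positivity
        · exact integrable_finsetSum _ (fun j _ => hF j)
        · refine Filter.Eventually.of_forall fun x => ?_
          have h1 := (mix_bounds hn w hw hw1 (fun j => quadForm Sig (x - μ j)) b hb).2
          refine (mul_le_mul_of_nonneg_left h1 (sq_nonneg _)).trans ?_
          dsimp only
          rw [Finset.mul_sum]
          refine Finset.sum_le_sum fun j _ => ?_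
          have h := (quadForm_bounds Sig hSig γmax γmin hγmax hγmin (x - μ j)).2
          have e0 : isoGaussDens d σ x ^ 2 = C * Real.exp (-(∑ k, x k ^ 2) / σ) := by
            unfold isoGaussDens
            rw [mul_pow, ← hC, ← Real.exp_nat_mul]
            congr 2; push_cast; field_simp
          rw [e0]
          simp only [F]
          have h3 : b * quadForm Sig (x - μ j) / 2 ≤ t / 2 * ∑ k, (x - μ j) k ^ 2 := by
            have : t / 2 * ∑ k, (x - μ j) k ^ 2 = b / 2 * ((∑ k, (x - μ j) k ^ 2) / γmin) := by
              rw [ht]; field_simp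
            rw [this]; nlinarith
          have e4 : ∑ k, (x - μ j) k ^ 2 =
              ∑ k, x k ^ 2 - 2 * ∑ k, μ j k * x k + ∑ k, μ j k ^ 2 := by
            rw [Finset.mul_sum, ← Finset.sum_sub_distrib, ← Finset.sum_add_distrib]
            exact Finset.sum_congr rfl fun k _ => by simp only [Pi.sub_apply]; ring
          have e5 : ∑ k, -t * μ j k * x k = -t * ∑ k, μ j k * x k := by
            rw [Finset.mul_sum]; exact Finset.sum_congr rfl fun k _ => by ring
          have h6 : Real.exp (-(∑ k, x k ^ 2) / σ) * Real.exp (b * quadForm Sig (x - μ j) / 2) ≤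
              Real.exp (t / 2 * ∑ k, μ j k ^ 2) *
              Real.exp (-a * ∑ k, x k ^ 2 + ∑ k, -t * μ j k * x k) := by
            rw [← Real.exp_add, ← Real.exp_add, Real.exp_le_exp, e5]
            have : t / 2 * ∑ k, μ j k ^ 2 + (-a * ∑ k, x k ^ 2 + -t * ∑ k, μ j k * x k) =
              -(∑ k, x k ^ 2) / σ + t / 2 * ∑ k, (x - μ j) k ^ 2 := by
              rw [e4, ha]; ring
            rw [this]; linarith
          have h7 := mul_le_mul_of_nonneg_left h6 (mul_nonneg (hw j).le hC0)
          linarith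
    _ = ∑ j, ∫ x, F j x := integral_finsetSum _ (fun j _ => hF j)
    _ ≤ ∑ j, w j * (C * (Real.pi / a) ^ ((d : ℝ) / 2) * Real.exp (s₃ / (2 - s₂))) :=
        Finset.sum_le_sum fun j _ => hFv j
    _ = _ := by rw [← Finset.sum_mul, hw1, one_mul]

lemma prefactor_bound (d : ℕ) (b γmax γmin σ s₁ s₂ : ℝ) (hb : 0 < b) (hM : 0 < γmax)
    (hm : 0 < γmin) (hσ : 0 < σ) (hs₁ : 0 < s₁) (hs₂ : s₂ < 2) (h1 : s₁ ≤ b / γmin * σ)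
    (h2 : b / γmin * σ ≤ s₂) :
    (Real.pi / (b / (2 * γmax))) ^ ((d : ℝ) / 2) * (((2 * Real.pi * σ) ^ (-(d : ℝ) / 2)) ^ 2 *
      (Real.pi / (1 / σ - b / γmin / 2)) ^ ((d : ℝ) / 2)) ≤
    (γmax / γmin) ^ ((d : ℝ) / 2) * s₂ ^ ((d : ℝ) / 2) /
          (s₁ ^ d * (2 - s₂) ^ ((d : ℝ) / 2)) := by
  have hpi := Real.pi_pos
  set t := b / γmin * σ with ht
  have hs20 : 0 < s₂ := by linarith
  have h2s : 0 < 2 - s₂ := by linarith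
  have h2t : 0 < 2 - t := by linarith
  have ht0 : 0 < t := by linarith
  have e1 : 1 / σ - b / γmin / 2 = (2 - t) / (2 * σ) := by rw [ht]; field_simp
  have ea : ((2 * Real.pi * σ) ^ (-(d : ℝ) / 2)) ^ 2 =
      ((1 / (2 * Real.pi * σ)) ^ 2) ^ ((d : ℝ) / 2) := by
    rw [one_div, inv_pow, neg_div, Real.rpow_neg (by positivity), Real.inv_rpow (by positivity),
      inv_pow, ← Real.rpow_natCast, ← Real.rpow_mul (by positivity), ← Real.rpow_natCast,
      ← Real.rpow_mul (by positivity), mul_comm ((d : ℝ) / 2)]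
  have eb : s₁ ^ d = (s₁ ^ 2) ^ ((d : ℝ) / 2) := by
    rw [← Real.rpow_natCast s₁ 2, ← Real.rpow_mul hs₁.le, ← Real.rpow_natCast]
    congr 1; push_cast; ring
  have p1 : 0 < (2 - t) / (2 * σ) := by positivity
  rw [e1, ea, eb, ← Real.mul_rpow (by positivity) (by positivity),
    ← Real.mul_rpow (by positivity) (by positivity), ← Real.mul_rpow (by positivity) (by positivity),
    ← Real.mul_rpow (by positivity) (by positivity), ← Real.div_rpow (by positivity) (by positivity)]
  apply Real.rpow_le_rpow (by positivity) _ (by positivity)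
  have e3 : Real.pi / (b / (2 * γmax)) * ((1 / (2 * Real.pi * σ)) ^ 2 *
      (Real.pi / ((2 - t) / (2 * σ)))) = (γmax / γmin) * (1 / (t * (2 - t))) := by
    have : b = t * γmin / σ := by rw [ht]; field_simp
    rw [this]; field_simp; try norm_num
  rw [e3, mul_div_assoc]
  refine mul_le_mul_of_nonneg_left ?_ (by positivity)
  rw [div_le_div_iff₀ (by positivity) (by positivity)]
  have : s₁ ^ 2 ≤ s₂ * t := by nlinarith
  have : s₁ ^ 2 * (2 - s₂) ≤ s₂ * t * (2 - t) := by
    apply mul_le_mul this (by linarith) h2s.le (by positivity)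
  linarith

theorem stmt17 (d L n : ℕ) (hd : 0 < d) (hL : 2 ≤ L) (hn : 0 < n)
    (μ : Fin n → Fin d → ℝ)
    (Sig : Matrix (Fin d) (Fin d) ℝ) (hSig : Sig.PosDef)
    (γmax γmin : ℝ)
    (hγmax : IsGreatest (Set.range hSig.isHermitian.eigenvalues) γmax)
    (hγmin : IsLeast (Set.range hSig.isHermitian.eigenvalues) γmin)
    (w : Fin n → ℝ) (hw : ∀ j, 0 < w j) (hw1 : ∑ j, w j = 1)
    (β : Fin L → ℝ) (hβ : ∀ i, 0 < β i) (hβ1 : β ⟨0, by omega⟩ ≤ 1)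
    (rr : Fin L → ℝ) (hrr : ∀ i, 0 < rr i) (hrr1 : ∑ i, rr i = 1)
    (D : ℝ) (hD : D = max (sSup (Set.range fun k => euclNorm (μ k))) (Real.sqrt γmin))
    -- normalized tempered densities `p*ᵢ ∝ exp(-βᵢ f)`
    (Zs : Fin L → ℝ)
    (hZs : ∀ i, Zs i = ∫ x, Real.exp (-(β i) * mixPotential Sig μ w x))
    (hZspos : ∀ i, 0 < Zs i)
    (pstar : Fin L → (Fin d → ℝ) → ℝ)
    (hpstar : ∀ i x, pstar i x = Real.exp (-(β i) * mixPotential Sig μ w x) / Zs i)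
    -- constants governing the initialization
    (s₁ s₂ s₃ : ℝ) (hs₁ : 0 < s₁) (hs₁₂ : s₁ ≤ s₂) (hs₂ : s₂ < 2) (hs₃ : 0 < s₃)
    (σ0sq : ℝ)
    (hσlo : s₁ * γmin / β ⟨0, by omega⟩ ≤ σ0sq)
    (hσhi : σ0sq ≤ s₂ * γmin / β ⟨0, by omega⟩)
    (hβD : β ⟨0, by omega⟩ ≤ s₃ * γmin / D ^ 2)
    -- the density `f₀ = dP⁰/dP`: all initial mass on level 1, with density `N(0, σ₀² I)`
    (f0 : Fin L × (Fin d → ℝ) → ℝ)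
    (hf0 : ∀ i x, f0 (i, x) =
      if i = ⟨0, by omega⟩ then
        isoGaussDens d σ0sq x / (rr ⟨0, by omega⟩ * pstar ⟨0, by omega⟩ x)
      else 0) :
    ∑ i : Fin L, ∫ x, f0 (i, x) ^ 2 * (rr i * pstar i x)
      ≤ (γmax / γmin) ^ ((d : ℝ) / 2) * s₂ ^ ((d : ℝ) / 2) /
          (s₁ ^ d * (2 - s₂) ^ ((d : ℝ) / 2) * rr ⟨0, by omega⟩ * (⨅ j, w j)) *
        Real.exp (s₃ / (2 - s₂)) := by
  have : Nonempty (Fin n) := ⟨⟨0, hn⟩⟩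
  have hwm : 0 < ⨅ j, w j := by
    obtain ⟨j, hj⟩ := exists_eq_ciInf_of_finite (f := w)
    rw [← hj]; exact hw j
  have hm : 0 < γmin := by
    obtain ⟨i, hi⟩ := hγmin.1
    exact hi ▸ hSig.eigenvalues_pos i
  have hM : 0 < γmax := by
    obtain ⟨i, hi⟩ := hγmax.1
    exact hi ▸ hSig.eigenvalues_pos i
  have hL0 : 0 < L := by omega
  set z : Fin L := ⟨0, hL0⟩ with hz
  have hb := hβ z
  have hr := hrr z
  have hσ : 0 < σ0sq := lt_of_lt_of_le (by positivity) hσlo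
  have h1 : s₁ ≤ β z / γmin * σ0sq := by
    rw [div_le_iff₀ hb] at hσlo
    rw [div_mul_eq_mul_div, le_div_iff₀ hm]; linarith
  have h2 : β z / γmin * σ0sq ≤ s₂ := by
    rw [le_div_iff₀ hb] at hσhi
    rw [div_mul_eq_mul_div, div_le_iff₀ hm]; linarith
  have hDpos : 0 < D := by
    rw [hD]; exact lt_max_of_lt_right (Real.sqrt_pos.2 hm)
  have hμ : ∀ j, β z / γmin * ∑ k, μ j k ^ 2 ≤ s₃ := fun j => by
    have hle : euclNorm (μ j) ≤ D := by
      rw [hD]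
      exact le_max_of_le_left (le_csSup (Set.finite_range _).bddAbove ⟨j, rfl⟩)
    have hsq : ∑ k, μ j k ^ 2 ≤ D ^ 2 := (Real.sqrt_le_left hDpos.le).1 hle
    rw [le_div_iff₀ (by positivity)] at hβD
    rw [div_mul_eq_mul_div, div_le_iff₀ hm]
    nlinarith
  have hsum : ∑ i : Fin L, ∫ x, f0 (i, x) ^ 2 * (rr i * pstar i x) =
      Zs z / rr z * ∫ x, isoGaussDens d σ0sq x ^ 2 *
        (1 / Real.exp (-(β z) * mixPotential Sig μ w x)) := by
    rw [Finset.sum_eq_single z]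
    · rw [← integral_const_mul]
      congr 1; funext x
      rw [hf0, if_pos rfl, hpstar]
      have hZ := hZspos z
      have := Real.exp_pos (-(β z) * mixPotential Sig μ w x)
      field_simp
    · intro i _ hi
      simp only [hf0]
      simp [if_neg hi]
    · simp
  have hZb := Z_bound hn μ Sig hSig γmax γmin hγmax hγmin w hw hw1 (β z) hb hM hwm
  rw [← hZs z] at hZb
  have hI := cross_bound hn μ Sig hSig γmax γmin hγmax hγmin w hw hw1 (β z) hb hm σ0sq s₂ s₃ hσ hs₂
    h2 hμ hs₃
  have hP := prefactor_bound d (β z) γmax γmin σ0sq s₁ s₂ hb hM hm hσ hs₁ hs₂ h1 h2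
  have hI0 : 0 ≤ ∫ x, isoGaussDens d σ0sq x ^ 2 *
        (1 / Real.exp (-(β z) * mixPotential Sig μ w x)) :=
    integral_nonneg fun x => by
      have := Real.exp_pos (-(β z) * mixPotential Sig μ w x)
      dsimp only [Pi.zero_apply]
      positivity
  rw [hsum]
  set A := (Real.pi / (β z / (2 * γmax))) ^ ((d : ℝ) / 2) with hA
  have hA0 : 0 ≤ A := by positivity
  calc _ ≤ ((1 / ⨅ j, w j) * A) / rr z *
        (((2 * Real.pi * σ0sq) ^ (-(d : ℝ) / 2)) ^ 2 *
      (Real.pi / (1 / σ0sq - β z / γmin / 2)) ^ ((d : ℝ) / 2) * Real.exp (s₃ / (2 - s₂))) := by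
        apply mul_le_mul _ hI hI0 (by positivity)
        gcongr
    _ = (A * (((2 * Real.pi * σ0sq) ^ (-(d : ℝ) / 2)) ^ 2 *
      (Real.pi / (1 / σ0sq - β z / γmin / 2)) ^ ((d : ℝ) / 2))) *
        ((1 / ⨅ j, w j) / rr z * Real.exp (s₃ / (2 - s₂))) := by ring
    _ ≤ _ := mul_le_mul_of_nonneg_right hP (by positivity)
    _ = _ := by
        simp only [div_eq_mul_inv, mul_inv, one_mul]
        ring
end
end
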